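/- Gårding inequality: let ρ ∈ ℂ with Re ρ = inf_Ω ε_r⁻¹ > 0 and Im ρ < 0, and for smooth biperiodic fields H : Ω̄ → ℂ³ with H₃ = 0 on Γ₀ set B(H,H) = ∫_Ω ( ε_r⁻¹ |curl_α H|² − k² |H|² + ρ |div_α H|² ) dx + ∫_{Γ_h} (e₃×(R_α×H)) · conj(H) ds − ∫_{Γ_h} (R_α·H) conj(H₃) ds. Then there exist constants c₁ > 0 and c₂ > 0 such that Re B(H,H) ≥ c₁ ∫_Ω |∇_α H|² dx − c₂ ∫_Ω |H|² dx for all such fields H, where |∇_α H|² = Σ_{j=1}^{3} |∇_α H_j|². -/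

import Mathlib

open MeasureTheory Real

noncomputable section

abbrev R3 : Type := Fin 3 → ℝ
abbrev C3 : Type := Fin 3 → ℂ

/-- Partial derivative of a complex-valued function on `ℝ³`. -/
def pdC (i : Fin 3) (f : R3 → ℂ) (x : R3) : ℂ := fderiv ℝ f x (Pi.single i 1)

/-- Partial derivative of a real-valued function on `ℝ³`. -/
def pdR (i : Fin 3) (f : R3 → ℝ) (x : R3) : ℝ := fderiv ℝ f x (Pi.single i 1)

/-- The shifted partial derivative `∂^α f/∂x_i = ∂f/∂x_i + i α_i f`. -/
def pdA (α : R3) (i : Fin 3) (f : R3 → ℂ) (x : R3) : ℂ :=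
  pdC i f x + Complex.I * (α i : ℂ) * f x

/-- Componentwise partial derivative of a vector field. -/
def pdV (i : Fin 3) (F : R3 → C3) (x : R3) : C3 := fun j => pdC i (fun y => F y j) x

def realToC3 (a : R3) : C3 := fun i => (a i : ℂ)

/-- Cross product of complex 3-vectors. -/
def crossC (a b : C3) : C3 :=
  ![a 1 * b 2 - a 2 * b 1, a 2 * b 0 - a 0 * b 2, a 0 * b 1 - a 1 * b 0]

/-- Cross product of real 3-vectors. -/
def crossR (a b : R3) : R3 :=
  ![a 1 * b 2 - a 2 * b 1, a 2 * b 0 - a 0 * b 2, a 0 * b 1 - a 1 * b 0]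

/-- The unit vector `e₃ = (0,0,1)` as a complex vector. -/
def e3 : C3 := ![0, 0, 1]

/-- `ã = (a₁,a₂,−a₃)`. -/
def tld (a : R3) : R3 := ![a 0, a 1, -(a 2)]

/-- The curl of a complex vector field on `ℝ³`. -/
def curlF (F : R3 → C3) (x : R3) : C3 :=
  ![pdC 1 (fun y => F y 2) x - pdC 2 (fun y => F y 1) x,
    pdC 2 (fun y => F y 0) x - pdC 0 (fun y => F y 2) x,
    pdC 0 (fun y => F y 1) x - pdC 1 (fun y => F y 0) x]

/-- `curl_α F = curl F + i α × F`. -/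
def curlA (α : R3) (F : R3 → C3) (x : R3) : C3 :=
  curlF F x + Complex.I • crossC (realToC3 α) (F x)

/-- The divergence of a complex vector field. -/
def divFld (F : R3 → C3) (x : R3) : ℂ := ∑ i, pdC i (fun y => F y i) x

/-- `div_α F = div F + i α · F`. -/
def divA (α : R3) (F : R3 → C3) (x : R3) : ℂ :=
  divFld F x + Complex.I * ∑ i, (α i : ℂ) * F x i

/-- Squared Euclidean norm of a complex 3-vector. -/
def nsq (v : C3) : ℝ := ∑ i, Complex.normSq (v i)

/-- `a · conj b` for complex 3-vectors. -/
def dotc (a b : C3) : ℂ := ∑ i, a i * (starRingEnd ℂ) (b i)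

/-- Plain (bilinear) dot product of complex 3-vectors. -/
def dotp (a b : C3) : ℂ := ∑ i, a i * b i

/-- Componentwise complex conjugate of a vector. -/
def conjV (v : C3) : C3 := fun i => (starRingEnd ℂ) (v i)

/-- Transverse part `(v₁, v₂, 0)` of a vector. -/
def vecT (v : C3) : C3 := ![v 0, v 1, 0]

/-- The periodicity cell `Ω = (0,2π)² × (0,h)`. -/
def Omg (h : ℝ) : Set R3 :=
  {x | x 0 ∈ Set.Ioo 0 (2 * π) ∧ x 1 ∈ Set.Ioo 0 (2 * π) ∧ x 2 ∈ Set.Ioo 0 h}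

/-- The square `(0,2π)²` parametrizing the horizontal boundary faces. -/
def sq2 : Set (ℝ × ℝ) := Set.Ioo 0 (2 * π) ×ˢ Set.Ioo 0 (2 * π)

/-- The point `(p₁, p₂, t) ∈ ℝ³`. -/
def bpt (p : ℝ × ℝ) (t : ℝ) : R3 := ![p.1, p.2, t]

/-- `2π`-periodicity in the first two variables. -/
def Biperiodic {E : Type*} (f : R3 → E) : Prop :=
  ∀ x : R3, f (x + (2 * π) • (Pi.single 0 1 : R3)) = f x ∧ f (x + (2 * π) • (Pi.single 1 1 : R3)) = f x

/-- Fourier coefficient of order `n ∈ ℤ²` of `H(·,·,t)` on the square `(0,2π)²`. -/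
def fcoeff (H : R3 → C3) (n : ℤ × ℤ) (t : ℝ) : C3 := fun j =>
  (1 / (4 * (π : ℂ) ^ 2)) *
    ∫ p in sq2, H (bpt p t) j *
      Complex.exp (-Complex.I * (((n.1 : ℝ) * p.1 + (n.2 : ℝ) * p.2 : ℝ) : ℂ))

/-- `β_n = √(k²−|n+α|²)` if `k² ≥ |n+α|²`, and `i √(|n+α|²−k²)` otherwise. -/
def betaN (k : ℝ) (α : R3) (n : ℤ × ℤ) : ℂ :=
  if ((n.1 : ℝ) + α 0) ^ 2 + ((n.2 : ℝ) + α 1) ^ 2 ≤ k ^ 2 then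
    ((Real.sqrt (k ^ 2 - (((n.1 : ℝ) + α 0) ^ 2 + ((n.2 : ℝ) + α 1) ^ 2)) : ℝ) : ℂ)
  else
    Complex.I * ((Real.sqrt ((((n.1 : ℝ) + α 0) ^ 2 + ((n.2 : ℝ) + α 1) ^ 2) - k ^ 2) : ℝ) : ℂ)

/-- The exterior Dirichlet-to-Neumann operator `T_α` applied to the `j`-th component of
the trace of `H` on `Γ_h`, evaluated at the boundary point `(p₁,p₂,h)`. -/
def Talpha (k : ℝ) (α : R3) (H : R3 → C3) (h : ℝ) (j : Fin 3) (p : ℝ × ℝ) : ℂ :=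
  ∑' n : ℤ × ℤ, Complex.I * betaN k α n * fcoeff H n h j *
    Complex.exp (Complex.I * (((n.1 : ℝ) * p.1 + (n.2 : ℝ) * p.2 : ℝ) : ℂ))

/-- Standing hypotheses on `ε_r⁻¹`: `C¹`, biperiodic, positive and bounded away from
zero, and equal to `1` near `Γ_h`. -/
structure EpsOK (h : ℝ) (εinv : R3 → ℝ) : Prop where
  smooth : ContDiff ℝ 1 εinv
  periodic : Biperiodic εinv
  pos : ∃ c : ℝ, 0 < c ∧ ∀ x, c ≤ εinv x
  one_near_top : ∃ η : ℝ, 0 < η ∧ η < h ∧ ∀ x : R3, h - η < x 2 → εinv x = 1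

/-- A homogeneous radiating solution of the biperiodic scattering problem. -/
structure IsHomSol (h k : ℝ) (α : R3) (εinv : R3 → ℝ) (H : R3 → C3) : Prop where
  smooth : ContDiff ℝ 2 H
  periodic : Biperiodic H
  maxwell : ∀ x ∈ Omg h, curlA α (fun y => (εinv y : ℂ) • curlA α H y) x = (k ^ 2 : ℂ) • H x
  divfree : ∀ x ∈ Omg h, divA α H x = 0
  bc_normal : ∀ x : R3, x 2 = 0 → H x 2 = 0
  bc_tangential : ∀ x : R3, x 2 = 0 → crossC e3 ((εinv x : ℂ) • curlA α H x) = 0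
  radiation : ∀ n : ℤ × ℤ, ∀ j : Fin 3,
    deriv (fun t => fcoeff H n t j) h = Complex.I * betaN k α n * fcoeff H n h j

/-- The non-trapping assumptions (a), (b), (c) on `ε_r⁻¹`. -/
def NonTrapping (h : ℝ) (εinv : R3 → ℝ) : Prop :=
  (∀ x ∈ Omg h, pdR 2 εinv x ≤ 0) ∧
  (∃ U : Set R3, IsOpen U ∧ U.Nonempty ∧ U ⊆ Omg h ∧ ∀ x ∈ U, pdR 2 εinv x < 0) ∧
  (∃ δ : ℝ, 1 / 2 < δ ∧ ∃ Mt Mz : ℝ,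
    (∀ x ∈ Omg h, (pdR 0 εinv x) ^ 2 + (pdR 1 εinv x) ^ 2 ≤ Mt ^ 2) ∧
    (∀ x ∈ Omg h, |pdR 2 εinv x| ≤ Mz) ∧
    δ / 2 * Mt ^ 2 + Real.sqrt 2 / h * Mz < 2 / h ^ 2)

/-! ### Calculus of the shifted partial derivatives -/

open scoped ComplexConjugate

lemma contDiff_pdC {u : R3 → ℂ} (hu : ContDiff ℝ (⊤ : ℕ∞) u) (i : Fin 3) :
    ContDiff ℝ (⊤ : ℕ∞) (pdC i u) := by
  unfold pdC
  have h1 : ContDiff ℝ (⊤ : ℕ∞) (fderiv ℝ u) := hu.fderiv_right (by simp)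
  exact h1.clm_apply contDiff_const

lemma contDiff_pdA (α : R3) {u : R3 → ℂ} (hu : ContDiff ℝ (⊤ : ℕ∞) u) (i : Fin 3) :
    ContDiff ℝ (⊤ : ℕ∞) (pdA α i u) := by
  unfold pdA
  exact (contDiff_pdC hu i).add (contDiff_const.mul hu)

lemma contDiff_conj {u : R3 → ℂ} (hu : ContDiff ℝ (⊤ : ℕ∞) u) :
    ContDiff ℝ (⊤ : ℕ∞) (fun x => conj (u x)) :=
  Complex.conjCLE.contDiff.comp hu

lemma differentiable_of_smooth {u : R3 → ℂ} (hu : ContDiff ℝ (⊤ : ℕ∞) u) : Differentiable ℝ u :=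
  hu.differentiable (by simp)

lemma Biperiodic.pdC {u : R3 → ℂ} (hu : Biperiodic u) (i : Fin 3) : Biperiodic (pdC i u) := by
  have key : ∀ a : R3, (∀ x, u (x + a) = u x) → ∀ x, _root_.pdC i u (x + a) = _root_.pdC i u x := by
    intro a ha x
    unfold _root_.pdC
    rw [← fderiv_comp_add_right a]
    simp only [ha]
  exact fun x => ⟨key _ (fun x => (hu x).1) x, key _ (fun x => (hu x).2) x⟩

lemma Biperiodic.pdA {u : R3 → ℂ} (hu : Biperiodic u) (α : R3) (i : Fin 3) :
    Biperiodic (pdA α i u) := by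
  intro x
  simp only [_root_.pdA, (hu x).1, (hu x).2, (hu.pdC i x).1, (hu.pdC i x).2, and_self]

lemma Biperiodic.mul {u v : R3 → ℂ} (hu : Biperiodic u) (hv : Biperiodic v) :
    Biperiodic (fun x => u x * v x) := by
  intro x
  simp only [(hu x).1, (hu x).2, (hv x).1, (hv x).2, and_self]

lemma Biperiodic.conj {u : R3 → ℂ} (hu : Biperiodic u) : Biperiodic (fun x => conj (u x)) := by
  intro x
  simp only [(hu x).1, (hu x).2, and_self]

lemma Biperiodic.apply {H : R3 → C3} (hH : Biperiodic H) (j : Fin 3) :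
    Biperiodic (fun x => H x j) := by
  intro x
  simp only [(hH x).1, (hH x).2, and_self]

lemma pdC_mul {u v : R3 → ℂ} (hu : Differentiable ℝ u) (hv : Differentiable ℝ v) (i : Fin 3)
    (x : R3) : pdC i (fun y => u y * v y) x = pdC i u x * v x + u x * pdC i v x := by
  unfold pdC
  rw [fderiv_fun_mul (hu x) (hv x)]
  simp
  ring

lemma pdC_conj {u : R3 → ℂ} (hu : Differentiable ℝ u) (i : Fin 3) (x : R3) :
    pdC i (fun y => conj (u y)) x = conj (pdC i u x) := by
  unfold pdC
  have := (Complex.conjCLE.toContinuousLinearMap.hasFDerivAt.comp x (hu x).hasFDerivAt).fderiv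
  exact congrArg (fun L : R3 →L[ℝ] ℂ => L (Pi.single i 1)) this

/-- Product rule: the shifts cancel in a product with a complex conjugate. -/
lemma pdC_mul_conj (α : R3) {u v : R3 → ℂ} (hu : Differentiable ℝ u) (hv : Differentiable ℝ v)
    (i : Fin 3) (x : R3) :
    pdC i (fun y => u y * conj (v y)) x = pdA α i u x * conj (v x) + u x * conj (pdA α i v x) := by
  have hv' : Differentiable ℝ (fun y => conj (v y)) :=
    Complex.conjCLE.toContinuousLinearMap.differentiable.comp hv
  rw [pdC_mul hu hv', pdC_conj hv]
  simp only [pdA, map_add, map_mul, Complex.conj_I, Complex.conj_ofReal]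
  ring

lemma pdC_comm {u : R3 → ℂ} (hu : ContDiff ℝ (⊤ : ℕ∞) u) (i j : Fin 3) (x : R3) :
    pdC i (pdC j u) x = pdC j (pdC i u) x := by
  have h1 : Differentiable ℝ (fderiv ℝ u) :=
    (hu.fderiv_right (m := (⊤ : ℕ∞)) (by simp)).differentiable (by simp)
  have key : ∀ i j : Fin 3, pdC i (pdC j u) x
      = fderiv ℝ (fderiv ℝ u) x (Pi.single i 1) (Pi.single j 1) := by
    intro i j
    have : HasFDerivAt (pdC j u) ((fderiv ℝ (fderiv ℝ u) x).flip (Pi.single j 1)) x := by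
      have := (h1 x).hasFDerivAt.clm_apply (hasFDerivAt_const (Pi.single j (1 : ℝ) : R3) x)
      rw [ContinuousLinearMap.comp_zero, zero_add] at this
      exact this
    rw [pdC, this.fderiv]
    rfl
  rw [key, key]
  exact (hu.contDiffAt.isSymmSndFDerivAt (by
    rw [minSmoothness_of_isRCLikeNormedField]; exact WithTop.coe_le_coe.2 (le_top : (2 : ℕ∞) ≤ ⊤))) _ _

lemma pdC_add_const_mul {u v : R3 → ℂ} (hu : Differentiable ℝ u) (hv : Differentiable ℝ v) (c : ℂ)
    (i : Fin 3) (x : R3) : pdC i (fun y => u y + c * v y) x = pdC i u x + c * pdC i v x := by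
  unfold pdC
  rw [fderiv_fun_add (hu x) ((hv x).const_mul c), fderiv_const_mul (hv x)]
  simp

lemma pdA_comm (α : R3) {u : R3 → ℂ} (hu : ContDiff ℝ (⊤ : ℕ∞) u) (i j : Fin 3) (x : R3) :
    pdA α i (pdA α j u) x = pdA α j (pdA α i u) x := by
  have h0 := differentiable_of_smooth hu
  have h1 := fun i => differentiable_of_smooth (contDiff_pdC hu i)
  have e : ∀ j, pdA α j u = fun y => pdC j u y + (Complex.I * (α j : ℂ)) * u y := fun j => rfl
  have key : ∀ i j, pdA α i (pdA α j u) x = pdC i (pdC j u) x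
      + Complex.I * (α j : ℂ) * pdC i u x + Complex.I * (α i : ℂ) * pdC j u x
      - (α i : ℂ) * (α j : ℂ) * u x := by
    intro i j
    rw [e j, pdA, pdC_add_const_mul (h1 j) h0]
    linear_combination (α i : ℂ) * (α j : ℂ) * u x * Complex.I_mul_I
  rw [key, key, pdC_comm hu]
  ring

/-! ### Integration over horizontal slices and over the periodicity cell -/

lemma continuous_bpt : Continuous fun q : (ℝ × ℝ) × ℝ => bpt q.1 q.2 := by
  unfold bpt
  refine continuous_pi fun i => ?_
  fin_cases i <;> simp <;> fun_prop

lemma continuous_bpt_left (t : ℝ) : Continuous fun p : ℝ × ℝ => bpt p t :=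
  continuous_bpt.comp (by fun_prop : Continuous fun p : ℝ × ℝ => (p, t))

lemma sq2_subset : sq2 ⊆ Set.Icc 0 (2 * π) ×ˢ Set.Icc 0 (2 * π) :=
  Set.prod_mono Set.Ioo_subset_Icc_self Set.Ioo_subset_Icc_self

lemma integrableOn_sq2 {E : Type*} [NormedAddCommGroup E] {f : ℝ × ℝ → E} (hf : Continuous f) :
    IntegrableOn f sq2 :=
  (hf.continuousOn.integrableOn_compact (isCompact_Icc.prod isCompact_Icc)).mono_set sq2_subset

lemma integral_sq2 {E : Type*} [NormedAddCommGroup E] [NormedSpace ℝ E] {f : ℝ × ℝ → E}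
    (hf : Continuous f) :
    ∫ p in sq2, f p = ∫ x in (0 : ℝ)..2 * π, ∫ y in (0 : ℝ)..2 * π, f (x, y) := by
  have hp : (0 : ℝ) ≤ 2 * π := by positivity
  have := setIntegral_prod (μ := volume) (ν := volume) f (integrableOn_sq2 hf)
  rw [intervalIntegral.integral_of_le hp, integral_Ioc_eq_integral_Ioo]
  simp only [intervalIntegral.integral_of_le hp, integral_Ioc_eq_integral_Ioo]
  exact this

lemma integral_sq2_swap {E : Type*} [NormedAddCommGroup E] [NormedSpace ℝ E] {f : ℝ × ℝ → E}
    (hf : Continuous f) :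
    ∫ p in sq2, f p = ∫ y in (0 : ℝ)..2 * π, ∫ x in (0 : ℝ)..2 * π, f (x, y) := by
  have hp : (0 : ℝ) ≤ 2 * π := by positivity
  have h1 := setIntegral_prod (μ := volume) (ν := volume) f (integrableOn_sq2 hf)
  have h2 : Integrable (Function.uncurry fun x y => f (x, y))
      ((volume.restrict (Set.Ioo 0 (2 * π))).prod (volume.restrict (Set.Ioo 0 (2 * π)))) := by
    have := integrableOn_sq2 hf
    rw [IntegrableOn, sq2, Measure.volume_eq_prod, ← Measure.prod_restrict] at this
    exact this
  rw [intervalIntegral.integral_of_le hp, integral_Ioc_eq_integral_Ioo]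
  simp only [intervalIntegral.integral_of_le hp, integral_Ioc_eq_integral_Ioo]
  rw [← integral_integral_swap h2]
  exact h1

lemma hasDerivAt_comp_update {F : R3 → ℂ} (hF : Differentiable ℝ F) (i : Fin 3) {c : ℝ → R3}
    {x : ℝ} (hc : HasDerivAt c (Pi.single i 1) x) : HasDerivAt (fun s => F (c s)) (pdC i F (c x)) x :=
  (hF (c x)).hasFDerivAt.comp_hasDerivAt x hc

lemma hasDerivAt_bpt_fst (y t x : ℝ) : HasDerivAt (fun s => bpt (s, y) t) (Pi.single 0 1) x := by
  rw [hasDerivAt_pi]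
  intro i
  fin_cases i <;> simp [bpt, hasDerivAt_id', hasDerivAt_const]

lemma hasDerivAt_bpt_snd (y t x : ℝ) : HasDerivAt (fun s => bpt (y, s) t) (Pi.single 1 1) x := by
  rw [hasDerivAt_pi]
  intro i
  fin_cases i <;> simp [bpt, hasDerivAt_id', hasDerivAt_const]

lemma hasDerivAt_bpt_height (p : ℝ × ℝ) (x : ℝ) :
    HasDerivAt (fun s => bpt p s) (Pi.single 2 1) x := by
  rw [hasDerivAt_pi]
  intro i
  fin_cases i <;> simp [bpt, hasDerivAt_id', hasDerivAt_const]

lemma bpt_add_fst (x y t : ℝ) :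
    bpt (x + 2 * π, y) t = bpt (x, y) t + (2 * π) • (Pi.single 0 1 : R3) := by
  ext i
  fin_cases i <;> simp [bpt]

lemma bpt_add_snd (x y t : ℝ) :
    bpt (x, y + 2 * π) t = bpt (x, y) t + (2 * π) • (Pi.single 1 1 : R3) := by
  ext i
  fin_cases i <;> simp [bpt]

lemma integral_sq2_pdC_zero {F : R3 → ℂ} (hF : ContDiff ℝ (⊤ : ℕ∞) F) (hp : Biperiodic F) (t : ℝ) :
    ∫ p in sq2, pdC 0 F (bpt p t) = 0 := by
  have hc : Continuous fun p => pdC 0 F (bpt p t) :=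
    (contDiff_pdC hF 0).continuous.comp (continuous_bpt_left t)
  rw [integral_sq2_swap hc]
  have : ∀ y, ∫ x in (0 : ℝ)..2 * π, pdC 0 F (bpt (x, y) t) = 0 := by
    intro y
    rw [intervalIntegral.integral_eq_sub_of_hasDerivAt (f := fun x => F (bpt (x, y) t))
      (fun x _ => hasDerivAt_comp_update (differentiable_of_smooth hF) 0 (hasDerivAt_bpt_fst y t x))
      ((hc.comp (by fun_prop : Continuous fun x : ℝ => (x, y))).intervalIntegrable _ _)]
    have := (hp (bpt (0, y) t)).1
    rw [← bpt_add_fst, zero_add] at this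
    rw [this, sub_self]
  simp [this]

lemma integral_sq2_pdC_one {F : R3 → ℂ} (hF : ContDiff ℝ (⊤ : ℕ∞) F) (hp : Biperiodic F) (t : ℝ) :
    ∫ p in sq2, pdC 1 F (bpt p t) = 0 := by
  have hc : Continuous fun p => pdC 1 F (bpt p t) :=
    (contDiff_pdC hF 1).continuous.comp (continuous_bpt_left t)
  rw [integral_sq2 hc]
  have : ∀ x, ∫ y in (0 : ℝ)..2 * π, pdC 1 F (bpt (x, y) t) = 0 := by
    intro x
    rw [intervalIntegral.integral_eq_sub_of_hasDerivAt (f := fun y => F (bpt (x, y) t))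
      (fun y _ => hasDerivAt_comp_update (differentiable_of_smooth hF) 1 (hasDerivAt_bpt_snd x t y))
      ((hc.comp (by fun_prop : Continuous fun y : ℝ => (x, y))).intervalIntegrable _ _)]
    have := (hp (bpt (x, 0) t)).2
    rw [← bpt_add_snd, zero_add] at this
    rw [this, sub_self]
  simp [this]

lemma integral_sq2_pdC {F : R3 → ℂ} (hF : ContDiff ℝ (⊤ : ℕ∞) F) (hp : Biperiodic F) (t : ℝ)
    {i : Fin 3} (hi : i ≠ 2) : ∫ p in sq2, pdC i F (bpt p t) = 0 := by
  fin_cases i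
  · exact integral_sq2_pdC_zero hF hp t
  · exact integral_sq2_pdC_one hF hp t
  · exact absurd rfl hi

lemma volume_preserving_bpt :
    MeasurePreserving (fun x : R3 => (((x 0, x 1) : ℝ × ℝ), x 2)) volume volume := by
  have h1 := volume_preserving_piFinSuccAbove (fun _ : Fin 3 => ℝ) 2
  have h2 := (volume_preserving_finTwoArrow ℝ).prod (MeasurePreserving.id (volume : Measure ℝ))
  have h3 := (Measure.measurePreserving_swap (μ := (volume : Measure ℝ))
    (ν := (volume : Measure (Fin 2 → ℝ))))
  exact h2.comp (h3.comp h1)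

lemma bpt_coords (x : R3) : bpt (x 0, x 1) (x 2) = x := by
  ext i
  fin_cases i <;> rfl

lemma integral_Omg_eq_prod {E : Type*} [NormedAddCommGroup E] [NormedSpace ℝ E] (h : ℝ)
    (F : R3 → E) :
    ∫ x in Omg h, F x = ∫ q in sq2 ×ˢ Set.Ioo 0 h, F (bpt q.1 q.2) := by
  have hm : MeasurableEmbedding (fun x : R3 => (((x 0, x 1) : ℝ × ℝ), x 2)) := by
    refine MeasurableEquiv.measurableEmbedding
      ⟨⟨fun x : R3 => (((x 0, x 1) : ℝ × ℝ), x 2), fun q => bpt q.1 q.2, bpt_coords, fun q => rfl⟩,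
        ?_, ?_⟩
    · exact volume_preserving_bpt.measurable
    · exact continuous_bpt.measurable
  rw [← volume_preserving_bpt.setIntegral_preimage_emb hm]
  simp only [bpt_coords]
  congr 2
  ext x
  simp [Omg, sq2, and_assoc]

lemma integrableOn_prod {E : Type*} [NormedAddCommGroup E] (h : ℝ)
    {F : R3 → E} (hF : Continuous F) :
    IntegrableOn (fun q : (ℝ × ℝ) × ℝ => F (bpt q.1 q.2)) (sq2 ×ˢ Set.Ioo 0 h) :=
  ((hF.comp continuous_bpt).continuousOn.integrableOn_compact
    ((isCompact_Icc.prod isCompact_Icc).prod isCompact_Icc)).mono_set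
      (Set.prod_mono sq2_subset Set.Ioo_subset_Icc_self)

lemma integral_Omg {E : Type*} [NormedAddCommGroup E] [NormedSpace ℝ E] {h : ℝ} (hh : 0 < h)
    {F : R3 → E} (hF : Continuous F) :
    ∫ x in Omg h, F x = ∫ p in sq2, ∫ t in (0 : ℝ)..h, F (bpt p t) := by
  rw [integral_Omg_eq_prod]
  simp only [intervalIntegral.integral_of_le hh.le, integral_Ioc_eq_integral_Ioo]
  exact setIntegral_prod (μ := volume) (ν := volume) _ (integrableOn_prod h hF)

lemma integral_Omg_swap {E : Type*} [NormedAddCommGroup E] [NormedSpace ℝ E] {h : ℝ} (hh : 0 < h)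
    {F : R3 → E} (hF : Continuous F) :
    ∫ x in Omg h, F x = ∫ t in (0 : ℝ)..h, ∫ p in sq2, F (bpt p t) := by
  rw [integral_Omg hh hF]
  simp only [intervalIntegral.integral_of_le hh.le, integral_Ioc_eq_integral_Ioo]
  refine integral_integral_swap ?_
  have := integrableOn_prod h hF
  rw [IntegrableOn, Measure.volume_eq_prod, ← Measure.prod_restrict] at this
  exact this

lemma Omg_subset_Icc (h : ℝ) : Omg h ⊆ Set.Icc 0 ![2 * π, 2 * π, h] := by
  rintro x ⟨h0, h1, h2⟩
  refine ⟨fun i => ?_, fun i => ?_⟩ <;> fin_cases i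
  exacts [h0.1.le, h1.1.le, h2.1.le, h0.2.le, h1.2.le, h2.2.le]

lemma integrableOn_Omg {E : Type*} [NormedAddCommGroup E] (h : ℝ) {F : R3 → E}
    (hF : Continuous F) : IntegrableOn F (Omg h) :=
  (hF.continuousOn.integrableOn_compact isCompact_Icc).mono_set (Omg_subset_Icc h)

lemma measurableSet_Omg (h : ℝ) : MeasurableSet (Omg h) := by
  unfold Omg
  refine (measurableSet_Ioo.preimage (measurable_pi_apply 0)).inter
    ((measurableSet_Ioo.preimage (measurable_pi_apply 1)).inter
      (measurableSet_Ioo.preimage (measurable_pi_apply 2)))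

lemma integral_Omg_pdC_horizontal {h : ℝ} (hh : 0 < h) {F : R3 → ℂ} (hF : ContDiff ℝ (⊤ : ℕ∞) F)
    (hp : Biperiodic F) {i : Fin 3} (hi : i ≠ 2) : ∫ x in Omg h, pdC i F x = 0 := by
  rw [integral_Omg_swap hh (contDiff_pdC hF i).continuous]
  simp [integral_sq2_pdC hF hp _ hi]

lemma integral_Omg_pdC_vertical {h : ℝ} (hh : 0 < h) {F : R3 → ℂ} (hF : ContDiff ℝ (⊤ : ℕ∞) F)
    (h0 : ∀ x : R3, x 2 = 0 → F x = 0) : ∫ x in Omg h, pdC 2 F x = ∫ p in sq2, F (bpt p h) := by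
  have hc := (contDiff_pdC hF 2).continuous
  rw [integral_Omg hh hc]
  congr 1
  ext p
  rw [intervalIntegral.integral_eq_sub_of_hasDerivAt (f := fun t => F (bpt p t))
      (fun t _ => hasDerivAt_comp_update (differentiable_of_smooth hF) 2 (hasDerivAt_bpt_height p t))
      ((hc.comp (continuous_bpt.comp (by fun_prop : Continuous fun t : ℝ => (p, t)))).intervalIntegrable _ _)]
  rw [h0 (bpt p 0) rfl, sub_zero]

/-! ### The energy identity -/

lemma smooth_apply {H : R3 → C3} (hH : ContDiff ℝ (⊤ : ℕ∞) H) (j : Fin 3) :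
    ContDiff ℝ (⊤ : ℕ∞) (fun x => H x j) :=
  contDiff_pi.1 hH j

/-- The null Lagrangian built from the components `i` and `j` of a field. -/
def nullLag (α : R3) (u v : R3 → ℂ) (i j : Fin 3) (x : R3) : ℂ :=
  pdA α i u x * conj (pdA α j v x) - pdA α j u x * conj (pdA α i v x)

lemma nullLag_eq_pdC (α : R3) {u v : R3 → ℂ} (hu : ContDiff ℝ (⊤ : ℕ∞) u)
    (hv : ContDiff ℝ (⊤ : ℕ∞) v) (i j : Fin 3) (x : R3) :
    nullLag α u v i j x = pdC j (fun y => pdA α i u y * conj (v y)) x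
      - pdC i (fun y => pdA α j u y * conj (v y)) x := by
  have hv' := differentiable_of_smooth hv
  rw [pdC_mul_conj α (differentiable_of_smooth (contDiff_pdA α hu i)) hv',
    pdC_mul_conj α (differentiable_of_smooth (contDiff_pdA α hu j)) hv', pdA_comm α hu i j, nullLag]
  ring

lemma continuous_nullLag (α : R3) {u v : R3 → ℂ} (hu : ContDiff ℝ (⊤ : ℕ∞) u)
    (hv : ContDiff ℝ (⊤ : ℕ∞) v) (i j : Fin 3) : Continuous (nullLag α u v i j) := by
  have h := fun i => (contDiff_pdA α hu i).continuous
  have h' := fun i => (contDiff_conj (contDiff_pdA α hv i)).continuous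
  exact ((h i).mul (h' j)).sub ((h j).mul (h' i))

lemma integral_nullLag_horizontal {h : ℝ} (hh : 0 < h) (α : R3) {u v : R3 → ℂ}
    (hu : ContDiff ℝ (⊤ : ℕ∞) u) (hv : ContDiff ℝ (⊤ : ℕ∞) v) (pu : Biperiodic u)
    (pv : Biperiodic v) {i j : Fin 3} (hi : i ≠ 2) (hj : j ≠ 2) :
    ∫ x in Omg h, nullLag α u v i j x = 0 := by
  have s : ∀ i, ContDiff ℝ (⊤ : ℕ∞) (fun y => pdA α i u y * conj (v y)) :=
    fun i => (contDiff_pdA α hu i).mul (contDiff_conj hv)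
  have p : ∀ i, Biperiodic (fun y => pdA α i u y * conj (v y)) := fun i => (pu.pdA α i).mul pv.conj
  simp only [nullLag_eq_pdC α hu hv]
  rw [integral_sub (integrableOn_Omg h (contDiff_pdC (s i) j).continuous)
    (integrableOn_Omg h (contDiff_pdC (s j) i).continuous),
    integral_Omg_pdC_horizontal hh (s i) (p i) hj, integral_Omg_pdC_horizontal hh (s j) (p j) hi,
    sub_zero]

lemma integral_nullLag_vertical {h : ℝ} (hh : 0 < h) (α : R3) {u v : R3 → ℂ}
    (hu : ContDiff ℝ (⊤ : ℕ∞) u) (hv : ContDiff ℝ (⊤ : ℕ∞) v) (pu : Biperiodic u)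
    (pv : Biperiodic v) (v0 : ∀ x : R3, x 2 = 0 → v x = 0) {i : Fin 3} (hi : i ≠ 2) :
    ∫ x in Omg h, nullLag α u v i 2 x
      = ∫ p in sq2, pdA α i u (bpt p h) * conj (v (bpt p h)) := by
  have s : ∀ i, ContDiff ℝ (⊤ : ℕ∞) (fun y => pdA α i u y * conj (v y)) :=
    fun i => (contDiff_pdA α hu i).mul (contDiff_conj hv)
  have p : ∀ i, Biperiodic (fun y => pdA α i u y * conj (v y)) := fun i => (pu.pdA α i).mul pv.conj
  simp only [nullLag_eq_pdC α hu hv]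
  rw [integral_sub (integrableOn_Omg h (contDiff_pdC (s i) 2).continuous)
    (integrableOn_Omg h (contDiff_pdC (s 2) i).continuous),
    integral_Omg_pdC_vertical hh (s i) (fun x hx => by simp [v0 x hx]),
    integral_Omg_pdC_horizontal hh (s 2) (p 2) hi, sub_zero]

lemma curlA_eq (α : R3) (H : R3 → C3) (x : R3) :
    curlA α H x = ![pdA α 1 (fun y => H y 2) x - pdA α 2 (fun y => H y 1) x,
      pdA α 2 (fun y => H y 0) x - pdA α 0 (fun y => H y 2) x,
      pdA α 0 (fun y => H y 1) x - pdA α 1 (fun y => H y 0) x] := by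
  ext i
  fin_cases i <;> simp [curlA, curlF, crossC, pdA, realToC3] <;> ring

lemma divA_eq (α : R3) (H : R3 → C3) (x : R3) :
    divA α H x = ∑ i, pdA α i (fun y => H y i) x := by
  simp only [divA, divFld, pdA, Finset.sum_add_distrib, Finset.mul_sum, mul_assoc]

lemma nsq_curlA_add_normSq_divA (α : R3) (H : R3 → C3) (x : R3) :
    nsq (curlA α H x) + Complex.normSq (divA α H x)
      = (∑ j, ∑ i, Complex.normSq (pdA α i (fun y => H y j) x))
        + 2 * (nullLag α (fun y => H y 0) (fun y => H y 1) 0 1 x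
          + nullLag α (fun y => H y 0) (fun y => H y 2) 0 2 x
          + nullLag α (fun y => H y 1) (fun y => H y 2) 1 2 x).re := by
  rw [curlA_eq, divA_eq]
  simp only [nsq, nullLag, Fin.sum_univ_three, Complex.normSq_apply, Matrix.cons_val_zero,
    Matrix.cons_val_one, Matrix.cons_val, Complex.sub_re, Complex.sub_im, Complex.add_re,
    Complex.add_im, Complex.mul_re, Complex.conj_re, Complex.conj_im]
  ring

lemma continuous_nsq {F : R3 → C3} (hF : Continuous F) : Continuous fun x => nsq (F x) := by
  unfold nsq
  exact continuous_finsetSum _ fun i _ =>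
    Complex.continuous_normSq.comp ((continuous_apply i).comp hF)

lemma continuous_curlA (α : R3) {H : R3 → C3} (hH : ContDiff ℝ (⊤ : ℕ∞) H) :
    Continuous (curlA α H) := by
  have c := fun i j => (contDiff_pdA α (smooth_apply hH j) i).continuous
  have : curlA α H = _ := funext (curlA_eq α H)
  rw [this]
  refine continuous_pi fun i => ?_
  fin_cases i
  exacts [(c 1 2).sub (c 2 1), (c 2 0).sub (c 0 2), (c 0 1).sub (c 1 0)]

lemma continuous_divA (α : R3) {H : R3 → C3} (hH : ContDiff ℝ (⊤ : ℕ∞) H) :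
    Continuous (divA α H) := by
  have : divA α H = _ := funext (divA_eq α H)
  rw [this]
  exact continuous_finsetSum _ fun i _ => (contDiff_pdA α (smooth_apply hH i) i).continuous

lemma continuous_sum_normSq_pdA (α : R3) {H : R3 → C3} (hH : ContDiff ℝ (⊤ : ℕ∞) H) :
    Continuous fun x => ∑ j, ∑ i, Complex.normSq (pdA α i (fun y => H y j) x) :=
  continuous_finsetSum _ fun j _ => continuous_finsetSum _ fun i _ =>
    Complex.continuous_normSq.comp (contDiff_pdA α (smooth_apply hH j) i).continuous

/-- The boundary integral `∫_{Γ_t} (∂^α₁ H₁ + ∂^α₂ H₂) conj H₃ ds`. -/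
def bdryCoupling (α : R3) (H : R3 → C3) (t : ℝ) : ℂ :=
  ∫ p in sq2, (pdA α 0 (fun y => H y 0) (bpt p t) + pdA α 1 (fun y => H y 1) (bpt p t))
    * conj (H (bpt p t) 2)

lemma integral_re_Omg {h : ℝ} {F : R3 → ℂ} (hF : Continuous F) :
    ∫ x in Omg h, (F x).re = (∫ x in Omg h, F x).re :=
  integral_re (𝕜 := ℂ) (integrableOn_Omg h hF)

lemma integral_curl_add_div {h : ℝ} (hh : 0 < h) (α : R3) {H : R3 → C3}
    (hH : ContDiff ℝ (⊤ : ℕ∞) H) (hp : Biperiodic H) (h0 : ∀ x : R3, x 2 = 0 → H x 2 = 0) :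
    ∫ x in Omg h, (nsq (curlA α H x) + Complex.normSq (divA α H x))
      = (∫ x in Omg h, ∑ j, ∑ i, Complex.normSq (pdA α i (fun y => H y j) x))
        + 2 * (bdryCoupling α H h).re := by
  have s := fun j => smooth_apply hH j
  have p := fun j => hp.apply j
  have c01 := continuous_nullLag α (s 0) (s 1) 0 1
  have c02 := continuous_nullLag α (s 0) (s 2) 0 2
  have c12 := continuous_nullLag α (s 1) (s 2) 1 2
  have cs : Continuous fun x => nullLag α (fun y => H y 0) (fun y => H y 1) 0 1 x
      + nullLag α (fun y => H y 0) (fun y => H y 2) 0 2 x := c01.add c02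
  have c3 : Continuous fun x => nullLag α (fun y => H y 0) (fun y => H y 1) 0 1 x
      + nullLag α (fun y => H y 0) (fun y => H y 2) 0 2 x
      + nullLag α (fun y => H y 1) (fun y => H y 2) 1 2 x := cs.add c12
  have ct : Continuous fun x => 2 * (nullLag α (fun y => H y 0) (fun y => H y 1) 0 1 x
      + nullLag α (fun y => H y 0) (fun y => H y 2) 0 2 x
      + nullLag α (fun y => H y 1) (fun y => H y 2) 1 2 x).re :=
    continuous_const.mul (Complex.continuous_re.comp c3)
  simp only [nsq_curlA_add_normSq_divA]
  rw [integral_add (integrableOn_Omg h (continuous_sum_normSq_pdA α hH)) (integrableOn_Omg h ct),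
    integral_const_mul, integral_re_Omg c3,
    integral_add (integrableOn_Omg h cs) (integrableOn_Omg h c12),
    integral_add (integrableOn_Omg h c01) (integrableOn_Omg h c02),
    integral_nullLag_horizontal hh α (s 0) (s 1) (p 0) (p 1) (by decide) (by decide),
    integral_nullLag_vertical hh α (s 0) (s 2) (p 0) (p 2) h0 (by decide),
    integral_nullLag_vertical hh α (s 1) (s 2) (p 1) (p 2) h0 (by decide), zero_add]
  have cb : ∀ i j, Continuous fun p => pdA α i (fun y => H y j) (bpt p h) * conj (H (bpt p h) 2) :=
    fun i j => ((contDiff_pdA α (s j) i).mul (contDiff_conj (s 2))).continuous.comp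
    (continuous_bpt_left h)
  rw [bdryCoupling]
  simp only [add_mul]
  rw [integral_add (integrableOn_sq2 (cb 0 0)) (integrableOn_sq2 (cb 1 1))]

/-- Integration by parts on a horizontal slice. -/
lemma integral_sq2_by_parts (α : R3) {u v : R3 → ℂ} (hu : ContDiff ℝ (⊤ : ℕ∞) u)
    (hv : ContDiff ℝ (⊤ : ℕ∞) v) (pu : Biperiodic u) (pv : Biperiodic v) (t : ℝ) {i : Fin 3}
    (hi : i ≠ 2) :
    ∫ p in sq2, pdA α i u (bpt p t) * conj (v (bpt p t))
      = - conj (∫ p in sq2, pdA α i v (bpt p t) * conj (u (bpt p t))) := by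
  have key := integral_sq2_pdC (hu.mul (contDiff_conj hv)) (pu.mul pv.conj) t hi
  have c1 : Continuous fun p => pdA α i u (bpt p t) * conj (v (bpt p t)) :=
    ((contDiff_pdA α hu i).mul (contDiff_conj hv)).continuous.comp (continuous_bpt_left t)
  have c2 : Continuous fun p => u (bpt p t) * conj (pdA α i v (bpt p t)) :=
    (hu.mul (contDiff_conj (contDiff_pdA α hv i))).continuous.comp (continuous_bpt_left t)
  simp only [pdC_mul_conj α (differentiable_of_smooth hu) (differentiable_of_smooth hv)] at key
  rw [integral_add (integrableOn_sq2 c1) (integrableOn_sq2 c2)] at key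
  rw [← integral_conj]
  simp only [map_mul, Complex.conj_conj]
  rw [eq_neg_iff_add_eq_zero, ← key]
  simp only [mul_comm]

/-! ### Fourier series of smooth biperiodic functions -/

/-- The exponential `e^{in·p}` on `ℝ²`. -/
def fmode (n : ℤ × ℤ) (p : ℝ × ℝ) : ℂ :=
  Complex.exp (Complex.I * (((n.1 : ℝ) * p.1 + (n.2 : ℝ) * p.2 : ℝ) : ℂ))

/-- Fourier coefficient of order `n` of a function on the square `(0,2π)²`. -/
def fcoef (f : ℝ × ℝ → ℂ) (n : ℤ × ℤ) : ℂ :=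
  (1 / (4 * (π : ℂ) ^ 2)) *
    ∫ p in sq2, f p * Complex.exp (-Complex.I * (((n.1 : ℝ) * p.1 + (n.2 : ℝ) * p.2 : ℝ) : ℂ))

lemma continuous_fmode (n : ℤ × ℤ) : Continuous (fmode n) := by
  unfold fmode
  fun_prop

lemma norm_fmode (n : ℤ × ℤ) (p : ℝ × ℝ) : ‖fmode n p‖ = 1 := by
  rw [fmode, mul_comm, Complex.norm_exp_ofReal_mul_I]

lemma exp_neg_eq_conj_fmode (n : ℤ × ℤ) (p : ℝ × ℝ) :
    Complex.exp (-Complex.I * (((n.1 : ℝ) * p.1 + (n.2 : ℝ) * p.2 : ℝ) : ℂ)) = conj (fmode n p) := by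
  rw [fmode, ← Complex.exp_conj, map_mul, Complex.conj_I, Complex.conj_ofReal]

lemma fcoef_eq (f : ℝ × ℝ → ℂ) (n : ℤ × ℤ) :
    fcoef f n = (1 / (4 * (π : ℂ) ^ 2)) * ∫ p in sq2, f p * conj (fmode n p) := by
  simp only [fcoef, exp_neg_eq_conj_fmode]

lemma integral_mul_conj_fmode (f : ℝ × ℝ → ℂ) (n : ℤ × ℤ) :
    ∫ p in sq2, f p * conj (fmode n p) = 4 * (π : ℂ) ^ 2 * fcoef f n := by
  have : (π : ℂ) ≠ 0 := by exact_mod_cast pi_ne_zero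
  rw [fcoef_eq]
  field_simp

lemma norm_fcoef_le (f : ℝ × ℝ → ℂ) (n : ℤ × ℤ) :
    ‖fcoef f n‖ ≤ ‖1 / (4 * (π : ℂ) ^ 2)‖ * ∫ p in sq2, ‖f p‖ := by
  rw [fcoef_eq, norm_mul]
  refine mul_le_mul_of_nonneg_left ((norm_integral_le_integral_norm _).trans_eq ?_) (norm_nonneg _)
  simp [norm_fmode]

lemma hasSum_fourier_of_summable {g : ℝ → ℂ} (hg : Continuous g) (hp : Function.Periodic g (2 * π))
    (hs : Summable fun n : ℤ => (1 / (2 * (π : ℂ))) *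
      ∫ x in (0 : ℝ)..2 * π, g x * Complex.exp (-Complex.I * ((n * x : ℝ) : ℂ))) (x : ℝ) :
    HasSum (fun n : ℤ => ((1 / (2 * (π : ℂ))) *
      ∫ x in (0 : ℝ)..2 * π, g x * Complex.exp (-Complex.I * ((n * x : ℝ) : ℂ))) *
        Complex.exp (Complex.I * ((n * x : ℝ) : ℂ))) (g x) := by
  have hpi : (π : ℂ) ≠ 0 := by exact_mod_cast pi_ne_zero
  have : Fact (0 < 2 * π) := ⟨two_pi_pos⟩
  let G : C(AddCircle (2 * π), ℂ) := ⟨hp.lift, hg.quotient_lift _⟩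
  have hG : ∀ y : ℝ, G (y : AddCircle (2 * π)) = g y := fun y => hp.lift_coe y
  have hfour : ∀ (n : ℤ) (y : ℝ), fourier n (y : AddCircle (2 * π))
      = Complex.exp (Complex.I * ((n * y : ℝ) : ℂ)) := by
    intro n y
    rw [fourier_coe_apply]
    congr 1
    push_cast
    field_simp
  have hcoef : ∀ n : ℤ, fourierCoeff G n = (1 / (2 * (π : ℂ))) *
      ∫ x in (0 : ℝ)..2 * π, g x * Complex.exp (-Complex.I * ((n * x : ℝ) : ℂ)) := by
    intro n
    rw [fourierCoeff_eq_intervalIntegral _ n 0, zero_add, Complex.real_smul]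
    push_cast
    congr 1
    refine intervalIntegral.integral_congr fun y _ => ?_
    simp only [hG, hfour, smul_eq_mul]
    rw [mul_comm]
    congr 2
    push_cast
    ring
  have := has_pointwise_sum_fourier_series_of_summable (f := G) (by
    refine hs.congr fun n => ?_
    exact (hcoef n).symm) (x : AddCircle (2 * π))
  simpa only [hcoef, hfour, hG, smul_eq_mul] using this

lemma hasSum_fcoef_mul_fmode {f : ℝ × ℝ → ℂ} (hf : Continuous f)
    (h1 : ∀ x y, f (x + 2 * π, y) = f (x, y)) (h2 : ∀ x y, f (x, y + 2 * π) = f (x, y))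
    (hs : Summable fun n => ‖fcoef f n‖) (p : ℝ × ℝ) :
    HasSum (fun n => fcoef f n * fmode n p) (f p) := by
  obtain ⟨x, y⟩ := p
  let c : ℤ → ℝ → ℂ := fun m x => (1 / (2 * (π : ℂ))) *
    ∫ y in (0 : ℝ)..2 * π, f (x, y) * Complex.exp (-Complex.I * ((m * y : ℝ) : ℂ))
  have hc_cont : ∀ m, Continuous (c m) := fun m =>
    continuous_const.mul (intervalIntegral.continuous_parametric_intervalIntegral_of_continuous'
      (f := fun x y => f (x, y) * Complex.exp (-Complex.I * ((m * y : ℝ) : ℂ)))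
      (by fun_prop) _ _)
  have hc_per : ∀ m, Function.Periodic (c m) (2 * π) := by
    intro m x
    simp only [c, h1]
  have hc_coef : ∀ (m l : ℤ), (1 / (2 * (π : ℂ))) *
      ∫ x in (0 : ℝ)..2 * π, c m x * Complex.exp (-Complex.I * ((l * x : ℝ) : ℂ))
        = fcoef f (l, m) := by
    intro m l
    rw [fcoef, integral_sq2 (by fun_prop)]
    simp only [c, mul_assoc, intervalIntegral.integral_const_mul]
    rw [← mul_assoc]
    congr 1
    · ring
    · refine intervalIntegral.integral_congr fun x _ => ?_
      rw [← intervalIntegral.integral_mul_const]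
      refine intervalIntegral.integral_congr fun y _ => ?_
      simp only [mul_assoc]
      rw [← Complex.exp_add]
      congr 2
      push_cast
      ring
  have hinner : ∀ m : ℤ, HasSum (fun l : ℤ => fcoef f (l, m) *
      Complex.exp (Complex.I * ((l * x : ℝ) : ℂ))) (c m x) := by
    intro m
    have := hasSum_fourier_of_summable (hc_cont m) (hc_per m) (by
      simp only [hc_coef]
      exact hs.of_norm.comp_injective (Prod.mk_left_injective m)) x
    simpa only [hc_coef] using this
  have hexp : ∀ t : ℝ, ‖Complex.exp (Complex.I * (t : ℂ))‖ = 1 := fun t => by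
    rw [mul_comm, Complex.norm_exp_ofReal_mul_I]
  have hsw : Summable fun n : ℤ × ℤ => ‖fcoef f n.swap‖ :=
    (Equiv.prodComm ℤ ℤ).summable_iff.2 hs
  have hc_sum : Summable fun m => c m x := by
    have : Summable fun n : ℤ × ℤ => fcoef f n.swap * Complex.exp (Complex.I * ((n.2 * x : ℝ) : ℂ)) :=
      Summable.of_norm (by simpa only [norm_mul, hexp, mul_one] using hsw)
    exact (this.hasSum.prod_fiberwise hinner).summable
  have houter : HasSum (fun m : ℤ => c m x * Complex.exp (Complex.I * ((m * y : ℝ) : ℂ))) (f (x, y)) :=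
    hasSum_fourier_of_summable (g := fun y => f (x, y)) (by fun_prop) (h2 x) hc_sum y
  have htot : Summable fun n : ℤ × ℤ => fcoef f n.swap * fmode n.swap (x, y) :=
    Summable.of_norm (by simpa only [norm_mul, norm_fmode, mul_one] using hsw)
  have hfib := htot.hasSum.prod_fiberwise (fun m => by
    have := (hinner m).mul_right (Complex.exp (Complex.I * ((m * y : ℝ) : ℂ)))
    refine this.congr_fun fun l => ?_
    rw [Prod.swap_prod_mk, fmode, mul_assoc, ← Complex.exp_add]
    push_cast
    ring_nf)
  rw [← (Equiv.prodComm ℤ ℤ).hasSum_iff, houter.unique hfib]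
  exact htot.hasSum

/-- Termwise integration of an absolutely convergent trigonometric series. -/
lemma hasSum_integral_trig_series {c : ℤ × ℤ → ℂ} (hc : Summable fun n => ‖c n‖) {g : ℝ × ℝ → ℂ}
    (hg : Continuous g) :
    HasSum (fun n => 4 * (π : ℂ) ^ 2 * (c n * conj (fcoef g n)))
      (∫ p in sq2, (∑' n, c n * fmode n p) * conj (g p)) := by
  have hgc : Continuous fun p => conj (g p) := Complex.continuous_conj.comp hg
  have := hasSum_integral_of_summable_integral_norm (μ := volume.restrict sq2)
    (F := fun (n : ℤ × ℤ) p => c n * fmode n p * conj (g p))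
    (fun n => integrableOn_sq2 ((continuous_const.mul (continuous_fmode n)).mul hgc)) (by
      simp only [norm_mul, norm_fmode, mul_one, integral_const_mul]
      exact hc.mul_right _)
  simp only [tsum_mul_right] at this
  refine this.congr_fun fun n => ?_
  simp only [mul_assoc, integral_const_mul]
  have key := congrArg conj (integral_mul_conj_fmode g n)
  rw [← integral_conj] at key
  simp only [map_mul, Complex.conj_conj, map_pow, Complex.conj_ofReal, map_ofNat] at key
  simp only [mul_comm (fmode n _), key]
  ring

lemma continuous_trig_series {c : ℤ × ℤ → ℂ} (hc : Summable fun n => ‖c n‖) :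
    Continuous fun p => ∑' n, c n * fmode n p :=
  continuous_tsum (fun n => continuous_const.mul (continuous_fmode n)) hc
    (fun n p => by rw [norm_mul, norm_fmode, mul_one])

/-- The exponential `e^{in·x}` as a function on `ℝ³`. -/
def fmode3 (n : ℤ × ℤ) (x : R3) : ℂ := fmode n (x 0, x 1)

lemma contDiff_fmode3 (n : ℤ × ℤ) : ContDiff ℝ (⊤ : ℕ∞) (fmode3 n) := by
  unfold fmode3 fmode
  refine Complex.contDiff_exp.comp (contDiff_const.mul (Complex.ofRealCLM.contDiff.comp ?_))
  exact (contDiff_const.mul (contDiff_apply ℝ ℝ 0)).add (contDiff_const.mul (contDiff_apply ℝ ℝ 1))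

lemma biperiodic_fmode3 (n : ℤ × ℤ) : Biperiodic (fmode3 n) := by
  intro x
  simp only [fmode3, fmode, Complex.exp_eq_exp_iff_exists_int]
  refine ⟨⟨n.1, ?_⟩, ⟨n.2, ?_⟩⟩ <;> simp <;> ring

lemma pdC_fmode3 (n : ℤ × ℤ) (i : Fin 3) (x : R3) :
    pdC i (fmode3 n) x = Complex.I * ((![(n.1 : ℝ), n.2, 0] i : ℝ) : ℂ) * fmode3 n x := by
  let L : R3 →L[ℝ] ℝ := (n.1 : ℝ) • ContinuousLinearMap.proj 0 + (n.2 : ℝ) • ContinuousLinearMap.proj 1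
  have e : fmode3 n = fun y => Complex.exp (Complex.I * (Complex.ofRealCLM.comp L) y) := rfl
  have h1 := ((Complex.ofRealCLM.comp L).hasFDerivAt (x := x)).const_mul Complex.I |>.cexp
  have hL : L (Pi.single i 1) = ![(n.1 : ℝ), n.2, 0] i := by
    fin_cases i <;> simp [L]
  rw [pdC, e, h1.fderiv, ← hL]
  simp only [smul_apply, ContinuousLinearMap.comp_apply, smul_eq_mul,
    Complex.ofRealCLM_apply]
  ring

lemma continuous_slice {u : R3 → ℂ} (hu : ContDiff ℝ (⊤ : ℕ∞) u) (t : ℝ) :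
    Continuous fun p => u (bpt p t) := hu.continuous.comp (continuous_bpt_left t)

lemma fcoef_pdC {u : R3 → ℂ} (hu : ContDiff ℝ (⊤ : ℕ∞) u) (pu : Biperiodic u) (t : ℝ) {i : Fin 3}
    (hi : i ≠ 2) (n : ℤ × ℤ) :
    fcoef (fun p => pdC i u (bpt p t)) n
      = Complex.I * ((![(n.1 : ℝ), n.2, 0] i : ℝ) : ℂ) * fcoef (fun p => u (bpt p t)) n := by
  have hE := contDiff_conj (contDiff_fmode3 n)
  have key := integral_sq2_pdC (hu.mul hE) (pu.mul (biperiodic_fmode3 n).conj) t hi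
  have c1 : Continuous fun p => pdC i u (bpt p t) * conj (fmode3 n (bpt p t)) :=
    continuous_slice ((contDiff_pdC hu i).mul hE) t
  have c2 : Continuous fun p => u (bpt p t) * conj (pdC i (fmode3 n) (bpt p t)) :=
    continuous_slice (hu.mul (contDiff_conj (contDiff_pdC (contDiff_fmode3 n) i))) t
  simp only [pdC_mul (differentiable_of_smooth hu) (differentiable_of_smooth hE),
    pdC_conj (differentiable_of_smooth (contDiff_fmode3 n))] at key
  rw [integral_add (integrableOn_sq2 c1) (integrableOn_sq2 c2)] at key
  have e2 : ∫ p in sq2, u (bpt p t) * conj (pdC i (fmode3 n) (bpt p t))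
      = -(Complex.I * ((![(n.1 : ℝ), n.2, 0] i : ℝ) : ℂ)) *
        ∫ p in sq2, u (bpt p t) * conj (fmode3 n (bpt p t)) := by
    rw [← integral_const_mul]
    congr 1
    ext p
    rw [pdC_fmode3, map_mul, map_mul, Complex.conj_I, Complex.conj_ofReal]
    ring
  rw [e2] at key
  have e3 : ∀ p : ℝ × ℝ, fmode3 n (bpt p t) = fmode n p := fun p => rfl
  simp only [e3] at key
  rw [fcoef_eq, fcoef_eq]
  linear_combination (1 / (4 * (π : ℂ) ^ 2)) * key

lemma fcoef_add_const_mul {f g : ℝ × ℝ → ℂ} (hf : Continuous f) (hg : Continuous g) (c : ℂ)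
    (n : ℤ × ℤ) : fcoef (fun p => f p + c * g p) n = fcoef f n + c * fcoef g n := by
  have hm : Continuous fun p => conj (fmode n p) :=
    Complex.continuous_conj.comp (continuous_fmode n)
  rw [fcoef_eq, fcoef_eq, fcoef_eq]
  simp only [add_mul, mul_assoc c]
  have hfm : Continuous fun p => f p * conj (fmode n p) := hf.mul hm
  have hgm : Continuous fun p => c * (g p * conj (fmode n p)) := continuous_const.mul (hg.mul hm)
  rw [integral_add (integrableOn_sq2 hfm) (integrableOn_sq2 hgm), integral_const_mul]
  ring

lemma fcoef_pdA (α : R3) {u : R3 → ℂ} (hu : ContDiff ℝ (⊤ : ℕ∞) u) (pu : Biperiodic u) (t : ℝ)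
    {i : Fin 3} (hi : i ≠ 2) (n : ℤ × ℤ) :
    fcoef (fun p => pdA α i u (bpt p t)) n
      = Complex.I * ((![(n.1 : ℝ), n.2, 0] i + α i : ℝ) : ℂ) * fcoef (fun p => u (bpt p t)) n := by
  have := fcoef_add_const_mul (continuous_slice (contDiff_pdC hu i) t) (continuous_slice hu t)
    (Complex.I * (α i : ℂ)) n
  rw [fcoef_pdC hu pu t hi] at this
  refine this.trans ?_
  push_cast
  ring

/-- `1 - ∂²/∂x_i²`, which multiplies Fourier coefficients by `1 + n_i²`. -/
def helmOp (i : Fin 3) (u : R3 → ℂ) (x : R3) : ℂ := u x + (-1) * pdC i (pdC i u) x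

lemma contDiff_helmOp {u : R3 → ℂ} (hu : ContDiff ℝ (⊤ : ℕ∞) u) (i : Fin 3) :
    ContDiff ℝ (⊤ : ℕ∞) (helmOp i u) :=
  hu.add (contDiff_const.mul (contDiff_pdC (contDiff_pdC hu i) i))

lemma biperiodic_helmOp {u : R3 → ℂ} (hu : Biperiodic u) (i : Fin 3) : Biperiodic (helmOp i u) := by
  intro x
  simp only [helmOp, (hu x).1, (hu x).2, (((hu.pdC i).pdC i) x).1, (((hu.pdC i).pdC i) x).2,
    and_self]

lemma fcoef_helmOp {u : R3 → ℂ} (hu : ContDiff ℝ (⊤ : ℕ∞) u) (pu : Biperiodic u) (t : ℝ)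
    {i : Fin 3} (hi : i ≠ 2) (n : ℤ × ℤ) :
    fcoef (fun p => helmOp i u (bpt p t)) n
      = ((1 + ![(n.1 : ℝ), n.2, 0] i ^ 2 : ℝ) : ℂ) * fcoef (fun p => u (bpt p t)) n := by
  have s1 := contDiff_pdC hu i
  have := fcoef_add_const_mul (continuous_slice hu t) (continuous_slice (contDiff_pdC s1 i) t)
    (-1) n
  rw [fcoef_pdC s1 (pu.pdC i) t hi, fcoef_pdC hu pu t hi] at this
  refine this.trans ?_
  push_cast
  linear_combination (-((![(n.1 : ℝ), n.2, 0] i : ℝ) : ℂ) ^ 2 * fcoef (fun p => u (bpt p t)) n)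
    * Complex.I_mul_I

lemma summable_one_div_one_add_sq :
    Summable fun n : ℤ × ℤ => 1 / ((1 + (n.1 : ℝ) ^ 2) * (1 + (n.2 : ℝ) ^ 2)) := by
  have h1 : Summable fun n : ℤ => 1 / (1 + (n : ℝ) ^ 2) := by
    have h2 : Summable fun n : ℤ => 1 / (n : ℝ) ^ 2 := Real.summable_one_div_int_pow.2 one_lt_two
    refine Summable.of_norm_bounded_eventually h2 ?_
    have : ∀ᶠ n : ℤ in Filter.cofinite, n ≠ 0 := Filter.eventually_cofinite_ne 0
    filter_upwards [this] with n hn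
    have : (0 : ℝ) < (n : ℝ) ^ 2 := by positivity
    rw [Real.norm_of_nonneg (by positivity)]
    exact one_div_le_one_div_of_le this (by linarith)
  refine (h1.mul_of_nonneg h1 (fun n => by positivity) (fun n => by positivity)).congr fun n => ?_
  field_simp

lemma summable_mul_norm_fcoef {u : R3 → ℂ} (hu : ContDiff ℝ (⊤ : ℕ∞) u) (pu : Biperiodic u)
    (t : ℝ) :
    Summable fun n : ℤ × ℤ => ((1 + (n.1 : ℝ) ^ 2) * (1 + (n.2 : ℝ) ^ 2)) *
      ‖fcoef (fun p => u (bpt p t)) n‖ := by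
  have s1 := contDiff_helmOp hu 0
  have s2 := contDiff_helmOp s1 0
  have s3 := contDiff_helmOp s2 1
  have p1 := biperiodic_helmOp pu 0
  have p2 := biperiodic_helmOp p1 0
  have p3 := biperiodic_helmOp p2 1
  have h1 : (1 : Fin 3) ≠ 2 := by decide
  have h0 : (0 : Fin 3) ≠ 2 := by decide
  set C := ‖1 / (4 * (π : ℂ) ^ 2)‖ *
    ∫ p in sq2, ‖helmOp 1 (helmOp 1 (helmOp 0 (helmOp 0 u))) (bpt p t)‖ with hC
  refine Summable.of_nonneg_of_le (fun n => by positivity) (fun n => ?_)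
    (summable_one_div_one_add_sq.mul_left C)
  have hle := norm_fcoef_le (fun p => helmOp 1 (helmOp 1 (helmOp 0 (helmOp 0 u))) (bpt p t)) n
  rw [fcoef_helmOp s3 p3 t h1, fcoef_helmOp s2 p2 t h1, fcoef_helmOp s1 p1 t h0,
    fcoef_helmOp hu pu t h0, ← hC] at hle
  simp only [norm_mul, Complex.norm_real, Matrix.cons_val_zero, Matrix.cons_val_one] at hle
  rw [Real.norm_of_nonneg (by positivity), Real.norm_of_nonneg (by positivity)] at hle
  rw [mul_one_div, le_div_iff₀ (by positivity)]
  linarith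

lemma summable_norm_fcoef {u : R3 → ℂ} (hu : ContDiff ℝ (⊤ : ℕ∞) u) (pu : Biperiodic u)
    (t : ℝ) : Summable fun n : ℤ × ℤ => ‖fcoef (fun p => u (bpt p t)) n‖ := by
  refine Summable.of_nonneg_of_le (fun n => norm_nonneg _) (fun n => ?_)
    (summable_mul_norm_fcoef hu pu t)
  refine le_mul_of_one_le_left (norm_nonneg _) ?_
  nlinarith [sq_nonneg (n.1 : ℝ), sq_nonneg (n.2 : ℝ),
    mul_nonneg (sq_nonneg (n.1 : ℝ)) (sq_nonneg (n.2 : ℝ))]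

/-- Parseval's identity for a smooth and a continuous function. -/
lemma hasSum_parseval {u : R3 → ℂ} (hu : ContDiff ℝ (⊤ : ℕ∞) u) (pu : Biperiodic u) (t : ℝ)
    {g : ℝ × ℝ → ℂ} (hg : Continuous g) :
    HasSum (fun n => 4 * (π : ℂ) ^ 2 * (fcoef (fun p => u (bpt p t)) n * conj (fcoef g n)))
      (∫ p in sq2, u (bpt p t) * conj (g p)) := by
  have hs := summable_norm_fcoef hu pu t
  have hsum : ∀ p, ∑' n, fcoef (fun p => u (bpt p t)) n * fmode n p = u (bpt p t) := fun p =>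
    (hasSum_fcoef_mul_fmode (continuous_slice hu t)
      (fun x y => by rw [bpt_add_fst]; exact (pu _).1)
      (fun x y => by rw [bpt_add_snd]; exact (pu _).2) hs p).tsum_eq
  simpa only [hsum] using hasSum_integral_trig_series hs hg

/-! ### The Dirichlet-to-Neumann operator on `Γ_h` -/

lemma norm_betaN_le (k : ℝ) (α : R3) (n : ℤ × ℤ) :
    ‖betaN k α n‖ ≤ (2 + k ^ 2 + 2 * α 0 ^ 2 + 2 * α 1 ^ 2) *
      ((1 + (n.1 : ℝ) ^ 2) * (1 + (n.2 : ℝ) ^ 2)) := by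
  set m := ((n.1 : ℝ) + α 0) ^ 2 + ((n.2 : ℝ) + α 1) ^ 2 with hm
  have hm0 : 0 ≤ m := by positivity
  have hsqrt : ∀ s : ℝ, s ≤ k ^ 2 + m → Real.sqrt s ≤ 1 + k ^ 2 + m := fun s hs => by
    rw [Real.sqrt_le_left (by positivity)]
    nlinarith [sq_nonneg k, sq_nonneg (k ^ 2 + m)]
  have h1 : ‖betaN k α n‖ ≤ 1 + k ^ 2 + m := by
    unfold betaN
    split_ifs
    · rw [Complex.norm_real, Real.norm_of_nonneg (Real.sqrt_nonneg _)]
      exact hsqrt _ (by linarith)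
    · rw [norm_mul, Complex.norm_I, one_mul, Complex.norm_real,
        Real.norm_of_nonneg (Real.sqrt_nonneg _)]
      exact hsqrt _ (by linarith [sq_nonneg k])
  have h2 : m ≤ 2 * (n.1 : ℝ) ^ 2 + 2 * (n.2 : ℝ) ^ 2 + 2 * α 0 ^ 2 + 2 * α 1 ^ 2 := by
    nlinarith [sq_nonneg ((n.1 : ℝ) - α 0), sq_nonneg ((n.2 : ℝ) - α 1)]
  have h3 : 1 + (n.1 : ℝ) ^ 2 + (n.2 : ℝ) ^ 2 ≤ (1 + (n.1 : ℝ) ^ 2) * (1 + (n.2 : ℝ) ^ 2) := by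
    nlinarith [mul_nonneg (sq_nonneg (n.1 : ℝ)) (sq_nonneg (n.2 : ℝ))]
  refine (h1.trans (?_ : _ ≤ (2 + k ^ 2 + 2 * α 0 ^ 2 + 2 * α 1 ^ 2) *
    (1 + (n.1 : ℝ) ^ 2 + (n.2 : ℝ) ^ 2))).trans (mul_le_mul_of_nonneg_left h3 (by positivity))
  have : 0 ≤ (k ^ 2 + 2 * α 0 ^ 2 + 2 * α 1 ^ 2) * ((n.1 : ℝ) ^ 2 + (n.2 : ℝ) ^ 2) := by positivity
  linarith

lemma betaN_im_nonneg (k : ℝ) (α : R3) (n : ℤ × ℤ) : 0 ≤ (betaN k α n).im := by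
  unfold betaN
  split_ifs <;> simp [Real.sqrt_nonneg]

lemma sqrt_sub_le_betaN_im {k : ℝ} (hk : 0 < k) (α : R3) (n : ℤ × ℤ) :
    Real.sqrt (((n.1 : ℝ) + α 0) ^ 2 + ((n.2 : ℝ) + α 1) ^ 2) - k ≤ (betaN k α n).im := by
  unfold betaN
  set m := ((n.1 : ℝ) + α 0) ^ 2 + ((n.2 : ℝ) + α 1) ^ 2 with hm
  have hm0 : 0 ≤ m := by positivity
  split_ifs with h
  · rw [Complex.ofReal_im, sub_nonpos]
    exact Real.sqrt_le_iff.2 ⟨hk.le, h⟩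
  · have him : (Complex.I * ((Real.sqrt (m - k ^ 2) : ℝ) : ℂ)).im = Real.sqrt (m - k ^ 2) := by simp
    rw [him]
    have hkm : k ≤ Real.sqrt m := Real.le_sqrt_of_sq_le (not_le.1 h).le
    refine Real.le_sqrt_of_sq_le ?_
    nlinarith [Real.sq_sqrt hm0]

lemma summable_Talpha (k : ℝ) (α : R3) {H : R3 → C3} (hH : ContDiff ℝ (⊤ : ℕ∞) H)
    (hp : Biperiodic H) (h : ℝ) (j : Fin 3) :
    Summable fun n => ‖Complex.I * betaN k α n * fcoef (fun p => H (bpt p h) j) n‖ := by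
  refine Summable.of_nonneg_of_le (fun n => norm_nonneg _) (fun n => ?_)
    ((summable_mul_norm_fcoef (smooth_apply hH j) (hp.apply j) h).mul_left
      (2 + k ^ 2 + 2 * α 0 ^ 2 + 2 * α 1 ^ 2))
  rw [norm_mul, norm_mul, Complex.norm_I, one_mul, ← mul_assoc]
  exact mul_le_mul_of_nonneg_right (norm_betaN_le k α n) (norm_nonneg _)

lemma continuous_Talpha (k : ℝ) (α : R3) {H : R3 → C3} (hH : ContDiff ℝ (⊤ : ℕ∞) H)
    (hp : Biperiodic H) (h : ℝ) (j : Fin 3) : Continuous (Talpha k α H h j) :=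
  continuous_trig_series (summable_Talpha k α hH hp h j)

/-- The quadratic form `∫_{Γ_h} (T_α H_j) conj H_j ds`. -/
def dtnForm (k : ℝ) (α : R3) (H : R3 → C3) (h : ℝ) (j : Fin 3) : ℂ :=
  ∫ p in sq2, Talpha k α H h j p * conj (H (bpt p h) j)

lemma hasSum_neg_re_dtnForm (k : ℝ) (α : R3) {H : R3 → C3} (hH : ContDiff ℝ (⊤ : ℕ∞) H)
    (hp : Biperiodic H) (h : ℝ) (j : Fin 3) :
    HasSum (fun n => 4 * π ^ 2 *
      ((betaN k α n).im * Complex.normSq (fcoef (fun p => H (bpt p h) j) n)))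
      (-(dtnForm k α H h j).re) := by
  have := (Complex.hasSum_re (hasSum_integral_trig_series (summable_Talpha k α hH hp h j)
    (continuous_slice (smooth_apply hH j) h))).neg
  refine this.congr_fun fun n => ?_
  rw [mul_assoc (Complex.I * betaN k α n), Complex.mul_conj]
  have e : (4 * (π : ℂ) ^ 2) = ((4 * π ^ 2 : ℝ) : ℂ) := by push_cast; ring
  rw [e, Complex.re_ofReal_mul, Complex.re_mul_ofReal]
  simp

lemma neg_re_dtnForm_nonneg (k : ℝ) (α : R3) {H : R3 → C3} (hH : ContDiff ℝ (⊤ : ℕ∞) H)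
    (hp : Biperiodic H) (h : ℝ) (j : Fin 3) : 0 ≤ -(dtnForm k α H h j).re :=
  (hasSum_neg_re_dtnForm k α hH hp h j).nonneg fun n =>
    mul_nonneg (by positivity) (mul_nonneg (betaN_im_nonneg k α n) (Complex.normSq_nonneg _))

lemma hasSum_normSq_fcoef {u : R3 → ℂ} (hu : ContDiff ℝ (⊤ : ℕ∞) u) (pu : Biperiodic u) (t : ℝ) :
    HasSum (fun n => 4 * π ^ 2 * Complex.normSq (fcoef (fun p => u (bpt p t)) n))
      (∫ p in sq2, Complex.normSq (u (bpt p t))) := by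
  have := Complex.hasSum_re (hasSum_parseval hu pu t (continuous_slice hu t))
  simp only [Complex.mul_conj] at this
  rw [integral_complex_ofReal, Complex.ofReal_re] at this
  refine this.congr_fun fun n => ?_
  have e : (4 * (π : ℂ) ^ 2) = ((4 * π ^ 2 : ℝ) : ℂ) := by push_cast; ring
  rw [e, ← Complex.ofReal_mul, Complex.ofReal_re]

lemma hasSum_bdryCoupling (α : R3) {H : R3 → C3} (hH : ContDiff ℝ (⊤ : ℕ∞) H)
    (hp : Biperiodic H) (h : ℝ) :
    HasSum (fun n : ℤ × ℤ => 4 * π ^ 2 * (Complex.I *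
      ((((n.1 : ℝ) + α 0 : ℝ) : ℂ) * fcoef (fun p => H (bpt p h) 0) n
        + (((n.2 : ℝ) + α 1 : ℝ) : ℂ) * fcoef (fun p => H (bpt p h) 1) n)
      * conj (fcoef (fun p => H (bpt p h) 2) n)).re) (bdryCoupling α H h).re := by
  have s := smooth_apply hH
  have g : Continuous fun p => H (bpt p h) 2 := continuous_slice (s 2) h
  have h0 := hasSum_parseval (contDiff_pdA α (s 0) 0) ((hp.apply 0).pdA α 0) h g
  have h1 := hasSum_parseval (contDiff_pdA α (s 1) 1) ((hp.apply 1).pdA α 1) h g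
  have c : ∀ i, Continuous fun p => pdA α i (fun y => H y i) (bpt p h) * conj (H (bpt p h) 2) :=
    fun i => ((contDiff_pdA α (s i) i).mul (contDiff_conj (s 2))).continuous.comp
      (continuous_bpt_left h)
  have hS := h0.add h1
  rw [← integral_add (integrableOn_sq2 (c 0)) (integrableOn_sq2 (c 1))] at hS
  simp only [← add_mul] at hS
  refine (Complex.hasSum_re hS).congr_fun fun n => ?_
  rw [fcoef_pdA α (s 0) (hp.apply 0) h (by decide), fcoef_pdA α (s 1) (hp.apply 1) h (by decide)]
  rw [← Complex.re_ofReal_mul]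
  congr 1
  simp only [Matrix.cons_val_zero, Matrix.cons_val_one]
  push_cast
  ring

lemma two_re_coupling_le (a b : ℝ) (u v w : ℂ) :
    2 * (Complex.I * ((a : ℂ) * u + (b : ℂ) * v) * conj w).re
      ≤ Real.sqrt (a ^ 2 + b ^ 2) * (Complex.normSq u + Complex.normSq v + Complex.normSq w) := by
  have hm0 : 0 ≤ a ^ 2 + b ^ 2 := by positivity
  set m := Real.sqrt (a ^ 2 + b ^ 2) with hm
  have hm2 : m ^ 2 = a ^ 2 + b ^ 2 := Real.sq_sqrt hm0
  rcases (Real.sqrt_nonneg (a ^ 2 + b ^ 2)).eq_or_lt with h | h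
  · have h0 : m = 0 := h.symm
    rw [h0] at hm2
    have ha : a = 0 := by nlinarith [sq_nonneg a, sq_nonneg b]
    have hb : b = 0 := by nlinarith [sq_nonneg a, sq_nonneg b]
    simp [ha, hb, h0]
  · refine le_of_mul_le_mul_left ?_ h
    rw [← hm, ← mul_assoc m m, ← sq, hm2]
    have e : (Complex.I * ((a : ℂ) * u + (b : ℂ) * v) * conj w).re
        = (a * u.re + b * v.re) * w.im - (a * u.im + b * v.im) * w.re := by
      simp
      ring
    rw [e]
    simp only [Complex.normSq_apply]
    have h1 := sq_nonneg ((a * u.re + b * v.re) - m * w.im)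
    have h2 := sq_nonneg ((a * u.im + b * v.im) + m * w.re)
    have h3 := sq_nonneg (a * v.re - b * u.re)
    have h4 := sq_nonneg (a * v.im - b * u.im)
    have h5 : m ^ 2 * (w.re * w.re + w.im * w.im) = (a ^ 2 + b ^ 2) * (w.re * w.re + w.im * w.im) := by
      rw [hm2]
    nlinarith

/-- The boundary coupling is controlled by the Dirichlet-to-Neumann operator, up to a trace term. -/
lemma dtnForm_coupling_bound {k : ℝ} (hk : 0 < k) (α : R3) {H : R3 → C3}
    (hH : ContDiff ℝ (⊤ : ℕ∞) H) (hp : Biperiodic H) (h : ℝ) {θ : ℝ} (hθ0 : 0 ≤ θ) (hθ1 : θ ≤ 1) :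
    -(k * ∑ j, ∫ p in sq2, Complex.normSq (H (bpt p h) j))
      ≤ (∑ j, -(dtnForm k α H h j).re) - θ * (2 * (bdryCoupling α H h).re) := by
  have hT := hasSum_sum (s := Finset.univ) fun j _ => hasSum_neg_re_dtnForm k α hH hp h j
  have hN := hasSum_sum (s := Finset.univ) fun j _ =>
    hasSum_normSq_fcoef (smooth_apply hH j) (hp.apply j) h
  have hS := hasSum_bdryCoupling α hH hp h
  refine hasSum_le (fun n => ?_) (hN.mul_left k).neg (hT.sub ((hS.mul_left 2).mul_left θ))
  simp only [Fin.sum_univ_three]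
  have h1 := two_re_coupling_le ((n.1 : ℝ) + α 0) ((n.2 : ℝ) + α 1)
    (fcoef (fun p => H (bpt p h) 0) n) (fcoef (fun p => H (bpt p h) 1) n)
    (fcoef (fun p => H (bpt p h) 2) n)
  have h2 := sqrt_sub_le_betaN_im hk α n
  have h3 := betaN_im_nonneg k α n
  have h4 := Real.sqrt_nonneg (((n.1 : ℝ) + α 0) ^ 2 + ((n.2 : ℝ) + α 1) ^ 2)
  set m := Real.sqrt (((n.1 : ℝ) + α 0) ^ 2 + ((n.2 : ℝ) + α 1) ^ 2)
  set γ := (betaN k α n).im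
  set N := Complex.normSq (fcoef (fun p => H (bpt p h) 0) n)
    + Complex.normSq (fcoef (fun p => H (bpt p h) 1) n)
    + Complex.normSq (fcoef (fun p => H (bpt p h) 2) n) with hNdef
  have hN0 : 0 ≤ N := add_nonneg (add_nonneg (Complex.normSq_nonneg _) (Complex.normSq_nonneg _))
    (Complex.normSq_nonneg _)
  set S := (Complex.I *
      ((((n.1 : ℝ) + α 0 : ℝ) : ℂ) * fcoef (fun p => H (bpt p h) 0) n
        + (((n.2 : ℝ) + α 1 : ℝ) : ℂ) * fcoef (fun p => H (bpt p h) 1) n)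
      * conj (fcoef (fun p => H (bpt p h) 2) n)).re
  have h5 : θ * m - k ≤ γ := by
    nlinarith [mul_le_mul_of_nonneg_right hθ1 h4]
  have h6 : θ * (2 * S) ≤ θ * (m * N) := mul_le_mul_of_nonneg_left h1 hθ0
  have h7 : (θ * m - k) * N ≤ γ * N := mul_le_mul_of_nonneg_right h5 hN0
  have h8 : 0 ≤ 4 * π ^ 2 * (γ * N - θ * (2 * S) + k * N) :=
    mul_nonneg (by positivity) (by linarith)
  rw [hNdef] at h8
  linarith

/-- The real part of the boundary terms of the sesquilinear form. -/
lemma re_boundary_terms (k : ℝ) (α : R3) {H : R3 → C3} (hH : ContDiff ℝ (⊤ : ℕ∞) H)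
    (hp : Biperiodic H) (h : ℝ) :
    ((∫ p in sq2,
        ((pdA α 1 (fun y => H y 2) (bpt p h) - Talpha k α H h 1 p) * conj (H (bpt p h) 1)
          - (Talpha k α H h 0 p - pdA α 0 (fun y => H y 2) (bpt p h)) * conj (H (bpt p h) 0)))
      - ∫ p in sq2,
        (pdA α 0 (fun y => H y 0) (bpt p h) + pdA α 1 (fun y => H y 1) (bpt p h)
          + Talpha k α H h 2 p) * conj (H (bpt p h) 2)).re
      = (∑ j, -(dtnForm k α H h j).re) - 2 * (bdryCoupling α H h).re := by
  have s := smooth_apply hH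
  have cH : ∀ j, Continuous fun p => conj (H (bpt p h) j) := fun j =>
    continuous_slice (contDiff_conj (s j)) h
  have cT : ∀ j, Continuous fun p => Talpha k α H h j p * conj (H (bpt p h) j) := fun j =>
    (continuous_Talpha k α hH hp h j).mul (cH j)
  have cD : ∀ i j l, Continuous fun p =>
      pdA α i (fun y => H y j) (bpt p h) * conj (H (bpt p h) l) := fun i j l =>
    (continuous_slice (contDiff_pdA α (s j) i) h).mul (cH l)
  have iT := fun j => integrableOn_sq2 (cT j)
  have iD := fun i j l => integrableOn_sq2 (cD i j l)
  have b0 := integral_sq2_by_parts α (s 2) (s 0) (hp.apply 2) (hp.apply 0) h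
    (i := 0) (by decide)
  have b1 := integral_sq2_by_parts α (s 2) (s 1) (hp.apply 2) (hp.apply 1) h
    (i := 1) (by decide)
  have eS : bdryCoupling α H h
      = (∫ p in sq2, pdA α 0 (fun y => H y 0) (bpt p h) * conj (H (bpt p h) 2))
        + ∫ p in sq2, pdA α 1 (fun y => H y 1) (bpt p h) * conj (H (bpt p h) 2) := by
    rw [← integral_add (iD 0 0 2) (iD 1 1 2)]
    simp only [bdryCoupling, add_mul]
  have e1 : (∫ p in sq2,
        ((pdA α 1 (fun y => H y 2) (bpt p h) - Talpha k α H h 1 p) * conj (H (bpt p h) 1)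
          - (Talpha k α H h 0 p - pdA α 0 (fun y => H y 2) (bpt p h)) * conj (H (bpt p h) 0)))
      = ((∫ p in sq2, pdA α 1 (fun y => H y 2) (bpt p h) * conj (H (bpt p h) 1))
          - dtnForm k α H h 1)
        - (dtnForm k α H h 0
          - ∫ p in sq2, pdA α 0 (fun y => H y 2) (bpt p h) * conj (H (bpt p h) 0)) := by
    rw [dtnForm, dtnForm, ← integral_sub (iD 1 2 1) (iT 1), ← integral_sub (iT 0) (iD 0 2 0)]
    simp only [sub_mul]
    exact integral_sub ((iD 1 2 1).sub (iT 1)) ((iT 0).sub (iD 0 2 0))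
  have e2 : (∫ p in sq2,
        (pdA α 0 (fun y => H y 0) (bpt p h) + pdA α 1 (fun y => H y 1) (bpt p h)
          + Talpha k α H h 2 p) * conj (H (bpt p h) 2))
      = bdryCoupling α H h + dtnForm k α H h 2 := by
    rw [eS, dtnForm, ← integral_add (iD 0 0 2) (iD 1 1 2)]
    simp only [add_mul]
    exact integral_add ((iD 0 0 2).add (iD 1 1 2)) (iT 2)
  rw [e1, e2, b0, b1, eS]
  simp only [Fin.sum_univ_three, Complex.sub_re, Complex.add_re, Complex.neg_re, Complex.conj_re]
  ring

/-! ### The trace inequality on `Γ_h` -/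

lemma integral_normSq_trace_le {h : ℝ} (hh : 0 < h) {α : R3} {u : R3 → ℂ}
    (hu : ContDiff ℝ (⊤ : ℕ∞) u) {δ : ℝ} (hδ : 0 < δ) :
    ∫ p in sq2, Complex.normSq (u (bpt p h))
      ≤ (1 / h + 1 / δ) * (∫ x in Omg h, Complex.normSq (u x))
        + δ * ∫ x in Omg h, Complex.normSq (pdA α 2 u x) := by
  let L : R3 →L[ℝ] ℂ :=
    Complex.ofRealCLM.comp (ContinuousLinearMap.proj (R := ℝ) (φ := fun _ : Fin 3 => ℝ) 2)
  have hL : ∀ x, L x = (x 2 : ℂ) := fun x => rfl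
  have sL : ContDiff ℝ (⊤ : ℕ∞) L := L.contDiff
  have dL : ∀ x, pdC 2 L x = 1 := fun x => by
    rw [pdC, L.fderiv, hL]
    simp
  have su : ContDiff ℝ (⊤ : ℕ∞) fun x => u x * conj (u x) := hu.mul (contDiff_conj hu)
  have sF : ContDiff ℝ (⊤ : ℕ∞) fun x => L x * (u x * conj (u x)) := sL.mul su
  have key := congrArg Complex.re
    (integral_Omg_pdC_vertical hh sF (fun x hx => by simp [hL, hx]))
  have hdu := differentiable_of_smooth hu
  have hpd : ∀ x, pdC 2 (fun x => L x * (u x * conj (u x))) x = ((Complex.normSq (u x) : ℝ) : ℂ)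
      + (x 2 : ℂ) * (pdA α 2 u x * conj (u x) + u x * conj (pdA α 2 u x)) := fun x => by
    rw [pdC_mul (differentiable_of_smooth sL) (differentiable_of_smooth su),
      pdC_mul_conj α hdu hdu, dL, hL, one_mul, Complex.mul_conj]
  have hR : ∫ p in sq2, L (bpt p h) * (u (bpt p h) * conj (u (bpt p h)))
      = ((h * ∫ p in sq2, Complex.normSq (u (bpt p h)) : ℝ) : ℂ) := by
    rw [← integral_const_mul, ← integral_complex_ofReal]
    refine integral_congr_ae (Filter.Eventually.of_forall fun p => ?_)
    simp only [hL, Complex.mul_conj, Complex.ofReal_mul]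
    rfl
  rw [← integral_re_Omg (contDiff_pdC sF 2).continuous, hR, Complex.ofReal_re] at key
  simp only [hpd] at key
  have cu : Continuous fun x => Complex.normSq (u x) :=
    Complex.continuous_normSq.comp hu.continuous
  have cd : Continuous fun x => Complex.normSq (pdA α 2 u x) :=
    Complex.continuous_normSq.comp (contDiff_pdA α hu 2).continuous
  have c1 : Continuous fun x : R3 => (1 + h / δ) * Complex.normSq (u x) := continuous_const.mul cu
  have c2 : Continuous fun x : R3 => (h * δ) * Complex.normSq (pdA α 2 u x) :=
    continuous_const.mul cd
  have hle : h * ∫ p in sq2, Complex.normSq (u (bpt p h))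
      ≤ ∫ x in Omg h, ((1 + h / δ) * Complex.normSq (u x)
        + (h * δ) * Complex.normSq (pdA α 2 u x)) := by
    rw [← key]
    refine setIntegral_mono_on (integrableOn_Omg h ?_) (integrableOn_Omg h (c1.add c2))
      (measurableSet_Omg h) fun x hx => ?_
    · have := Complex.continuous_re.comp (contDiff_pdC sF 2).continuous
      refine this.congr fun x => ?_
      rw [Function.comp_apply, hpd]
    · obtain ⟨-, -, hx0, hxh⟩ := hx
      have e : (((Complex.normSq (u x) : ℝ) : ℂ)
          + (x 2 : ℂ) * (pdA α 2 u x * conj (u x) + u x * conj (pdA α 2 u x))).re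
          = Complex.normSq (u x) + x 2 * (2 * (pdA α 2 u x * conj (u x)).re) := by
        simp only [Complex.add_re, Complex.ofReal_re, Complex.ofReal_im, Complex.mul_re,
          Complex.conj_re, Complex.conj_im]
        ring
      rw [e]
      have hy : 2 * (pdA α 2 u x * conj (u x)).re
          ≤ δ * Complex.normSq (pdA α 2 u x) + (1 / δ) * Complex.normSq (u x) := by
        set a := pdA α 2 u x
        set b := u x
        refine le_of_mul_le_mul_left ?_ hδ
        rw [mul_add, ← mul_assoc δ (1 / δ), mul_one_div_cancel hδ.ne']
        simp only [Complex.normSq_apply, Complex.mul_re, Complex.conj_re, Complex.conj_im]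
        nlinarith [sq_nonneg (δ * a.re - b.re), sq_nonneg (δ * a.im - b.im)]
      have hnn : 0 ≤ δ * Complex.normSq (pdA α 2 u x) + (1 / δ) * Complex.normSq (u x) :=
        add_nonneg (mul_nonneg hδ.le (Complex.normSq_nonneg _))
          (mul_nonneg (by positivity) (Complex.normSq_nonneg _))
      have h1 := mul_le_mul_of_nonneg_left hy hx0.le
      have h2 := mul_le_mul_of_nonneg_right hxh.le hnn
      have h3 : h * ((1 / δ) * Complex.normSq (u x)) = h / δ * Complex.normSq (u x) := by ring
      linarith
  rw [integral_add (integrableOn_Omg h c1) (integrableOn_Omg h c2), integral_const_mul,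
    integral_const_mul] at hle
  refine le_of_mul_le_mul_left (hle.trans_eq ?_) hh
  field_simp

lemma integral_nsq_trace_le {h : ℝ} (hh : 0 < h) (α : R3) {H : R3 → C3}
    (hH : ContDiff ℝ (⊤ : ℕ∞) H) {δ : ℝ} (hδ : 0 < δ) :
    ∑ j, ∫ p in sq2, Complex.normSq (H (bpt p h) j)
      ≤ (1 / h + 1 / δ) * (∫ x in Omg h, nsq (H x))
        + δ * ∫ x in Omg h, ∑ j, ∑ i, Complex.normSq (pdA α i (fun y => H y j) x) := by
  have s := smooth_apply hH
  have cu : ∀ j, IntegrableOn (fun x => Complex.normSq (H x j)) (Omg h) := fun j =>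
    integrableOn_Omg h (Complex.continuous_normSq.comp (s j).continuous)
  have cd : ∀ i j, Continuous fun x => Complex.normSq (pdA α i (fun y => H y j) x) := fun i j =>
    Complex.continuous_normSq.comp (contDiff_pdA α (s j) i).continuous
  have cd2 : ∀ j, Continuous fun x => ∑ i, Complex.normSq (pdA α i (fun y => H y j) x) := fun j =>
    continuous_finsetSum _ fun i _ => cd i j
  simp only [nsq]
  rw [integral_finsetSum _ fun j _ => cu j,
    integral_finsetSum _ fun j _ => integrableOn_Omg h (cd2 j), Finset.mul_sum, Finset.mul_sum,
    ← Finset.sum_add_distrib]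
  refine Finset.sum_le_sum fun j _ => (integral_normSq_trace_le hh (α := α) (s j) hδ).trans ?_
  refine add_le_add_right (mul_le_mul_of_nonneg_left ?_ hδ.le) _
  refine setIntegral_mono (integrableOn_Omg h (cd 2 j)) (integrableOn_Omg h (cd2 j)) fun x => ?_
  exact Finset.single_le_sum (f := fun i => Complex.normSq (pdA α i (fun y => H y j) x))
    (fun i _ => Complex.normSq_nonneg _) (Finset.mem_univ 2)

/-- Lower bound for the volume part of the sesquilinear form. -/
lemma volume_terms_ge (h k : ℝ) (α : R3) {εinv : R3 → ℝ} (hcont : Continuous εinv) {ρ : ℂ}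
    (hε : ∀ x ∈ Omg h, ρ.re ≤ εinv x) {H : R3 → C3} (hH : ContDiff ℝ (⊤ : ℕ∞) H) :
    ρ.re * (∫ x in Omg h, (nsq (curlA α H x) + Complex.normSq (divA α H x)))
        - k ^ 2 * (∫ x in Omg h, nsq (H x))
      ≤ (∫ x in Omg h, (((εinv x * nsq (curlA α H x) - k ^ 2 * nsq (H x) : ℝ) : ℂ)
          + ρ * (Complex.normSq (divA α H x) : ℂ))).re := by
  have cc := continuous_nsq (continuous_curlA α hH)
  have cd : Continuous fun x => Complex.normSq (divA α H x) :=
    Complex.continuous_normSq.comp (continuous_divA α hH)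
  have cH := continuous_nsq hH.continuous
  have cA : Continuous fun x => ρ.re * (nsq (curlA α H x) + Complex.normSq (divA α H x)) :=
    continuous_const.mul (cc.add cd)
  have cK : Continuous fun x => k ^ 2 * nsq (H x) := continuous_const.mul cH
  have cF : Continuous fun x => (((εinv x * nsq (curlA α H x) - k ^ 2 * nsq (H x) : ℝ) : ℂ)
      + ρ * (Complex.normSq (divA α H x) : ℂ)) :=
    (Complex.continuous_ofReal.comp ((hcont.mul cc).sub cK)).add
      (continuous_const.mul (Complex.continuous_ofReal.comp cd))
  rw [← integral_re_Omg cF, ← integral_const_mul, ← integral_const_mul,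
    ← integral_sub (integrableOn_Omg h cA) (integrableOn_Omg h cK)]
  refine setIntegral_mono_on (integrableOn_Omg h (cA.sub cK))
    (integrableOn_Omg h (Complex.continuous_re.comp cF)) (measurableSet_Omg h) fun x hx => ?_
  rw [Complex.add_re, Complex.ofReal_re, Complex.re_mul_ofReal]
  have : 0 ≤ nsq (curlA α H x) := Finset.sum_nonneg fun i _ => Complex.normSq_nonneg _
  nlinarith [mul_le_mul_of_nonneg_right (hε x hx) this]

/-- **Gårding inequality.** With `Re ρ = inf_Ω ε_r⁻¹ > 0` and `Im ρ < 0`,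
the sesquilinear form `B` satisfies `Re B(H,H) ≥ c₁ ∫_Ω |∇_α H|² − c₂ ∫_Ω |H|²` for all
smooth biperiodic fields `H` with vanishing normal component on `Γ₀`. -/
theorem garding_inequality
    (h : ℝ) (hh : 0 < h) (α : R3) (hα : α 2 = 0) (k : ℝ) (hk : 0 < k)
    (εinv : R3 → ℝ) (hcont : Continuous εinv) (hper : Biperiodic εinv)
    (hpos : ∃ c : ℝ, 0 < c ∧ ∀ x, c ≤ εinv x)
    (ρ : ℂ) (hρre : ρ.re = sInf (εinv '' Omg h)) (hρpos : 0 < ρ.re) (hρim : ρ.im < 0) :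
    ∃ c₁ c₂ : ℝ, 0 < c₁ ∧ 0 < c₂ ∧
      ∀ H : R3 → C3, ContDiff ℝ (⊤ : ℕ∞) H → Biperiodic H →
        (∀ x : R3, x 2 = 0 → H x 2 = 0) →
        ((∫ x in Omg h,
            (((εinv x * nsq (curlA α H x) - k ^ 2 * nsq (H x) : ℝ) : ℂ)
              + ρ * (Complex.normSq (divA α H x) : ℂ)))
          + (∫ p in sq2,
              ((pdA α 1 (fun y => H y 2) (bpt p h) - Talpha k α H h 1 p)
                  * (starRingEnd ℂ) (H (bpt p h) 1)
                - (Talpha k α H h 0 p - pdA α 0 (fun y => H y 2) (bpt p h))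
                  * (starRingEnd ℂ) (H (bpt p h) 0)))
          - (∫ p in sq2,
              (pdA α 0 (fun y => H y 0) (bpt p h) + pdA α 1 (fun y => H y 1) (bpt p h)
                  + Talpha k α H h 2 p)
                * (starRingEnd ℂ) (H (bpt p h) 2))).re
        ≥ c₁ * (∫ x in Omg h, ∑ j, ∑ i, Complex.normSq (pdA α i (fun y => H y j) x))
          - c₂ * (∫ x in Omg h, nsq (H x)) := by
  obtain ⟨c, -, hc⟩ := hpos
  have hε : ∀ x ∈ Omg h, ρ.re ≤ εinv x := fun x hx => by
    rw [hρre]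
    exact csInf_le ⟨c, by rintro _ ⟨y, -, rfl⟩; exact hc y⟩ ⟨x, hx, rfl⟩
  rcases le_or_gt 1 ρ.re with h1 | h1
  · refine ⟨1, k ^ 2, one_pos, by positivity, fun H hH hp h0 => ?_⟩
    rw [add_sub_assoc, Complex.add_re, re_boundary_terms k α hH hp h]
    have hvol := volume_terms_ge h k α hcont hε hH
    have hen := integral_curl_add_div hh α hH hp h0
    have hA : 0 ≤ ∫ x in Omg h, (nsq (curlA α H x) + Complex.normSq (divA α H x)) :=
      integral_nonneg fun x => add_nonneg
        (Finset.sum_nonneg fun i _ => Complex.normSq_nonneg _) (Complex.normSq_nonneg _)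
    have hT : 0 ≤ ∑ j, -(dtnForm k α H h j).re :=
      Finset.sum_nonneg fun j _ => neg_re_dtnForm_nonneg k α hH hp h j
    nlinarith [mul_nonneg (sub_nonneg.2 h1) hA]
  · refine ⟨ρ.re / 2, k ^ 2 + k * (1 / h + 1 / (ρ.re / (2 * k))), by positivity, by positivity,
      fun H hH hp h0 => ?_⟩
    rw [add_sub_assoc, Complex.add_re, re_boundary_terms k α hH hp h]
    have hvol := volume_terms_ge h k α hcont hε hH
    have hen := integral_curl_add_div hh α hH hp h0
    have hbd := dtnForm_coupling_bound hk α hH hp h (sub_nonneg.2 h1.le)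
      (sub_le_self 1 hρpos.le)
    have htr := mul_le_mul_of_nonneg_left
      (integral_nsq_trace_le hh α hH (δ := ρ.re / (2 * k)) (by positivity)) hk.le
    have hδ : k * (ρ.re / (2 * k)) = ρ.re / 2 := by field_simp
    rw [mul_add, ← mul_assoc, ← mul_assoc, hδ] at htr
    rw [hen] at hvol
    linarith
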